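/- Suppose the sequence $R_0,R_1,\dots\in A$ satisfies $R_0=2$ and the Gelfand–Dikii recursion $d R_{k+1}=-2U\,dR_k-R_k\,dU+\frac{\hbar^2}{4}\,d^3R_k$ for all $k\le j$. Then the matrix $\mathcal L_j$ satisfies, in $M_2(A[x])$: $\hbar\,d\mathcal L_j-[\mathcal R,\mathcal L_j]=\begin{pmatrix}0 & 0\\ -\hbar\,dR_{j+1} & 0\end{pmatrix}$, where $dR_{j+1}$ is regarded as a constant polynomial. -/

import Mathlib

open Polynomial

/-- Coefficientwise extension of a map `d : A → A` to the polynomial ring `A[x]`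
(so `dx = 0`). -/
noncomputable def dcoef {A : Type*} [CommRing A] (d : A → A) (p : Polynomial A) :
    Polynomial A :=
  p.sum fun n a => Polynomial.C (d a) * Polynomial.X ^ n

/-- `βⱼ = (1/2) ∑_{k=0}^{j} x^{j-k} R_k`. -/
noncomputable def betaGD {A : Type*} [CommRing A] [Algebra ℚ A] (R : ℕ → A) (j : ℕ) :
    Polynomial A :=
  (1/2 : ℚ) • ∑ k ∈ Finset.range (j + 1), X ^ (j - k) * C (R k)

/-- `αⱼ = -(ℏ/2) dβⱼ`. -/
noncomputable def alphaGD {A : Type*} [CommRing A] [Algebra ℚ A]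
    (d : A → A) (hbar : A) (R : ℕ → A) (j : ℕ) : Polynomial A :=
  (-(1/2 : ℚ)) • (C hbar * dcoef d (betaGD R j))

/-- `γⱼ = (x + 2U) βⱼ + ℏ dαⱼ`. -/
noncomputable def gammaGD {A : Type*} [CommRing A] [Algebra ℚ A]
    (d : A → A) (hbar U : A) (R : ℕ → A) (j : ℕ) : Polynomial A :=
  (X + 2 * C U) * betaGD R j + C hbar * dcoef d (alphaGD d hbar R j)

/-- The Gelfand–Dikii Lax matrix `ℒⱼ`. -/
noncomputable def LmatGD {A : Type*} [CommRing A] [Algebra ℚ A]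
    (d : A → A) (hbar U : A) (R : ℕ → A) (j : ℕ) :
    Matrix (Fin 2) (Fin 2) (Polynomial A) :=
  !![alphaGD d hbar R j, betaGD R j; gammaGD d hbar U R j, -alphaGD d hbar R j]

/-- The matrix `ℛ`. -/
noncomputable def RmatGD {A : Type*} [CommRing A] (U : A) :
    Matrix (Fin 2) (Fin 2) (Polynomial A) :=
  !![0, 1; X + 2 * C U, 0]

section Coefficientwise

variable {A : Type*} [CommRing A] [Algebra ℚ A] (d : Derivation ℚ A A)

theorem coeff_dcoef (p : A[X]) (n : ℕ) :
    (dcoef (fun a => d a) p).coeff n = d (p.coeff n) := by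
  rw [dcoef, Polynomial.sum_def, finsetSum_coeff]
  simp only [coeff_C_mul_X_pow]
  rw [Finset.sum_ite_eq]
  split_ifs with h
  · rfl
  · rw [notMem_support_iff.mp h, map_zero]

theorem dcoef_add (p q : A[X]) :
    dcoef (fun a => d a) (p + q) = dcoef (fun a => d a) p + dcoef (fun a => d a) q := by
  ext n
  simp [coeff_dcoef]

theorem dcoef_neg (p : A[X]) :
    dcoef (fun a => d a) (-p) = -dcoef (fun a => d a) p := by
  ext n
  simp [coeff_dcoef]

theorem dcoef_rat_smul (c : ℚ) (p : A[X]) :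
    dcoef (fun a => d a) (c • p) = c • dcoef (fun a => d a) p := by
  ext n
  simp [coeff_dcoef]

theorem dcoef_X_mul (p : A[X]) :
    dcoef (fun a => d a) (X * p) = X * dcoef (fun a => d a) p := by
  ext (_ | n) <;> simp [coeff_dcoef]

theorem dcoef_C (a : A) : dcoef (fun a => d a) (C a) = C (d a) := by
  ext n
  rw [coeff_dcoef, coeff_C, coeff_C]
  split_ifs <;> simp

theorem dcoef_C_mul (a : A) (p : A[X]) :
    dcoef (fun a => d a) (C a * p) =
      C (d a) * p + C a * dcoef (fun a => d a) p := by
  ext n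
  simp only [coeff_dcoef, coeff_C_mul, coeff_add, Derivation.leibniz, smul_eq_mul]
  ring

end Coefficientwise

theorem betaGD_zero {A : Type*} [CommRing A] [Algebra ℚ A] (R : ℕ → A) :
    betaGD R 0 = (1/2 : ℚ) • C (R 0) := by
  simp [betaGD]

theorem betaGD_succ {A : Type*} [CommRing A] [Algebra ℚ A] (R : ℕ → A) (j : ℕ) :
    betaGD R (j + 1) = X * betaGD R j + (1/2 : ℚ) • C (R (j + 1)) := by
  rw [betaGD, betaGD, Finset.sum_range_succ, smul_add, mul_smul_comm, Finset.mul_sum]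
  congr 2
  · refine Finset.sum_congr rfl fun k hk => ?_
    rw [Nat.succ_sub (Finset.mem_range_succ_iff.mp hk), pow_succ']
    ring
  · simp

theorem exists_half (B : Type*) [CommRing B] [Algebra ℚ B] :
    ∃ h : B, 2 * h = 1 ∧ (∀ b : B, (1/2 : ℚ) • b = h * b) ∧
      ∀ b : B, (1/4 : ℚ) • b = h ^ 2 * b := by
  refine ⟨algebraMap ℚ B (1/2), ?_, fun b => Algebra.smul_def _ _, fun b => ?_⟩
  · rw [← map_ofNat (algebraMap ℚ B), ← map_mul]
    norm_num
  · rw [← map_pow, ← Algebra.smul_def]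
    norm_num

/-- The telescoped Gelfand–Dikii recursion. -/
theorem betaGD_recursion {A : Type*} [CommRing A] [Algebra ℚ A] (d : Derivation ℚ A A)
    (hbar U : A) (R : ℕ → A) (j : ℕ) (hR0 : d (R 0) = 0)
    (hrec : ∀ k ≤ j, d (R (k + 1))
      = -(2 * U * d (R k)) - R k * d U + (1/4 : ℚ) • (hbar ^ 2 * d (d (d (R k))))) :
    2 * C (d U) * betaGD R j + 2 * (X + 2 * C U) * dcoef (fun a => d a) (betaGD R j)
      - (1/2 : ℚ) • (C hbar ^ 2 * dcoef (fun a => d a)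
          (dcoef (fun a => d a) (dcoef (fun a => d a) (betaGD R j))))
    = -C (d (R (j + 1))) := by
  obtain ⟨c, hc, half, quarter⟩ := exists_half A[X]
  induction j with
  | zero =>
    have h := congrArg (fun a : A => C a) (hrec 0 le_rfl)
    have h₀ : C (d (R 0)) = 0 := by rw [hR0, C_0]
    simp only [map_add, map_sub, map_neg, map_mul, map_pow, map_ofNat, ← smul_C] at h
    rw [h, betaGD_zero]
    simp only [dcoef_rat_smul, dcoef_C]
    simp only [half, quarter]
    linear_combination X * h₀ +
      (C (d U) * C (R 0) + (X + 2 * C U) * C (d (R 0))) * hc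
  | succ j ih =>
    have ih' := ih fun k hk => hrec k (hk.trans j.le_succ)
    have h := congrArg (fun a : A => C a) (hrec (j + 1) le_rfl)
    simp only [map_add, map_sub, map_neg, map_mul, map_pow, map_ofNat, ← smul_C] at h
    rw [h, betaGD_succ]
    simp only [dcoef_add, dcoef_X_mul, dcoef_rat_smul, dcoef_C]
    simp only [half, quarter] at ih' h ⊢
    linear_combination (X : A[X]) * ih' +
      (C (d U) * C (R (j + 1)) + (X + 2 * C U) * C (d (R (j + 1)))) * hc

/-- the Gelfand–Dikii recursion implies
`ℏ dℒⱼ - [ℛ, ℒⱼ] = !![0, 0; -ℏ dR_{j+1}, 0]`. -/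
theorem stmt8 {A : Type*} [CommRing A] [Algebra ℚ A] (d : Derivation ℚ A A)
    (hbar U : A) (hd : d hbar = 0) (R : ℕ → A) (j : ℕ)
    (hR0 : R 0 = 2)
    (hrec : ∀ k ≤ j, d (R (k + 1))
      = -(2 * U * d (R k)) - R k * d U + (1/4 : ℚ) • (hbar ^ 2 * d (d (d (R k))))) :
    C hbar • (LmatGD (fun a => d a) hbar U R j).map (dcoef fun a => d a)
      - (RmatGD U * LmatGD (fun a => d a) hbar U R j
          - LmatGD (fun a => d a) hbar U R j * RmatGD U)
    = !![0, 0; -(C hbar * C (d (R (j + 1)))), 0] := by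
  have hrec' := betaGD_recursion d hbar U R j (hR0 ▸ d.map_natCast 2) hrec
  obtain ⟨c, hc, half, -⟩ := exists_half A[X]
  have hX : ∀ p : A[X], dcoef (fun a => d a) ((X + 2 * C U) * p)
      = 2 * C (d U) * p + (X + 2 * C U) * dcoef (fun a => d a) p := fun p => by
    rw [add_mul, two_mul, add_mul, dcoef_add, dcoef_add, dcoef_X_mul, dcoef_C_mul]
    ring
  have hh : ∀ p : A[X], dcoef (fun a => d a) (C hbar * p)
      = C hbar * dcoef (fun a => d a) p := fun p => by
    rw [dcoef_C_mul, hd, map_zero, zero_mul, zero_add]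
  ext1 i k
  fin_cases i <;> fin_cases k <;>
    simp [LmatGD, RmatGD, gammaGD, alphaGD, dcoef_neg,
      dcoef_add, hX, hh, dcoef_rat_smul, -one_div]
  all_goals simp only [half] at hrec' ⊢
  · ring
  · linear_combination -(C hbar * dcoef (fun a => d a) (betaGD R j)) * hc
  · linear_combination C hbar * hrec' +
      (X + 2 * C U) * C hbar * dcoef (fun a => d a) (betaGD R j) * hc
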